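/- arXiv:1704.07819 — 7 statements merged into one kernel-verified Lean document; each statement's English description precedes it below -/
import Mathlib

section
/- The set L_F of all matrices M(a,x,y), for a ranging over trace-zero 3×3 matrices over F and x, y over F³, is an F-linear subspace of the 7×7 matrices over F that is closed under the commutator bracket [A,B] = AB − BA, and it has dimension 14 over F; that is, L_F is a 14-dimensional Lie subalgebra of gl₇(F). -/
open Matrix

noncomputable section

/-- Index type for `7×7` matrices in blocks of sizes `1, 3, 3`. -/
abbrev Idx := Fin 1 ⊕ (Fin 3 ⊕ Fin 3)

variable {F : Type} [Field F]

/-- The coordinate matrix `l_x` of `w ↦ x ×₃ w` on `F³`. -/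
def lmat (x : Fin 3 → F) : Matrix (Fin 3) (Fin 3) F :=
  !![0, -x 2, x 1; x 2, 0, -x 0; -x 1, x 0, 0]

/-- The `7×7` block matrix `M(a,x,y) = [[0, -2yᵀ, -2xᵀ], [x, a, l_y], [y, l_x, -aᵀ]]`. -/
def Mmat (a : Matrix (Fin 3) (Fin 3) F) (x y : Fin 3 → F) : Matrix Idx Idx F :=
  Matrix.fromBlocks 0
    (Matrix.of fun _ j => Sum.elim (fun k => -2 * y k) (fun k => -2 * x k) j)
    (Matrix.of fun i _ => Sum.elim x y i)
    (Matrix.fromBlocks a (lmat y) (lmat x) (-aᵀ))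

/-- `L_F`: the set of all `M(a,x,y)` for `a` trace-zero and `x, y ∈ F³`. -/
def LSet (F : Type) [Field F] : Set (Matrix Idx Idx F) :=
  {M | ∃ (a : Matrix (Fin 3) (Fin 3) F) (x y : Fin 3 → F),
    Matrix.trace a = 0 ∧ M = Mmat a x y}

/-- Statement 0 for a given field `F`: `L_F` is an `F`-subspace of the `7×7` matrices,
closed under the commutator bracket, of dimension `14`. -/
def Stmt0 (F : Type) [Field F] : Prop :=
  ∃ S : Submodule F (Matrix Idx Idx F),
    (S : Set (Matrix Idx Idx F)) = LSet F ∧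
    (∀ A ∈ S, ∀ B ∈ S, A * B - B * A ∈ S) ∧
    Module.finrank F S = 14

/-- The map `(a, x, y) ↦ M(a,x,y)` on all triples, as a linear map. -/
def MmatLinear (F : Type) [Field F] :
    (Matrix (Fin 3) (Fin 3) F × (Fin 3 → F) × (Fin 3 → F)) →ₗ[F] Matrix Idx Idx F where
  toFun p := Mmat p.1 p.2.1 p.2.2
  map_add' p q := by
    ext i j
    rcases i with i | i | i <;> rcases j with j | j | j <;> fin_cases i <;> fin_cases j <;>
      simp [Mmat, lmat] <;> ring
  map_smul' c p := by
    ext i j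
    rcases i with i | i | i <;> rcases j with j | j | j <;> fin_cases i <;> fin_cases j <;>
      simp [Mmat, lmat] <;> ring

lemma MmatLinear_injective : Function.Injective (MmatLinear F) := by
  rintro ⟨a, x, y⟩ ⟨b, z, w⟩ h
  have h' (i j) : Mmat a x y i j = Mmat b z w i j := congrFun (congrFun h i) j
  refine Prod.ext ?_ (Prod.ext ?_ ?_)
  · ext i j
    simpa [Mmat] using h' (.inr (.inl i)) (.inr (.inl j))
  · ext i
    simpa [Mmat] using h' (.inr (.inl i)) (.inl 0)
  · ext i
    simpa [Mmat] using h' (.inr (.inr i)) (.inl 0)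

set_option maxHeartbeats 4000000 in
/-- The commutator of two matrices `M(a,x,y)` with trace-zero `a` is again of this form. -/
lemma Mmat_commutator {a b : Matrix (Fin 3) (Fin 3) F} (ha : a.trace = 0) (hb : b.trace = 0)
    (x y z w : Fin 3 → F) :
    Mmat a x y * Mmat b z w - Mmat b z w * Mmat a x y =
      Mmat (a * b - b * a - (3 : F) • vecMulVec x w + (3 : F) • vecMulVec z y
          - (y ⬝ᵥ z - w ⬝ᵥ x) • (1 : Matrix (Fin 3) (Fin 3) F))
        (a *ᵥ z - b *ᵥ x + (2 : F) • (lmat y *ᵥ w))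
        ((2 : F) • (lmat x *ᵥ z) - aᵀ *ᵥ w + bᵀ *ᵥ y) := by
  have ha' : a 2 2 = -a 0 0 - a 1 1 := by
    rw [trace_fin_three] at ha
    linear_combination ha
  have hb' : b 2 2 = -b 0 0 - b 1 1 := by
    rw [trace_fin_three] at hb
    linear_combination hb
  ext i j
  rcases i with i | i | i <;> rcases j with j | j | j <;> fin_cases i <;> fin_cases j <;>
    simp [Mmat, lmat, mul_apply, mulVec, dotProduct, Fin.sum_univ_three, vecMulVec_apply,
      vecHead, vecTail, ha', hb'] <;> ring

lemma trace_commutator_block (a b : Matrix (Fin 3) (Fin 3) F) (x y z w : Fin 3 → F) :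
    (a * b - b * a - (3 : F) • vecMulVec x w + (3 : F) • vecMulVec z y
      - (y ⬝ᵥ z - w ⬝ᵥ x) • (1 : Matrix (Fin 3) (Fin 3) F)).trace = 0 := by
  simp only [trace_sub, trace_add, trace_smul, trace_mul_comm a b, trace_vecMulVec, trace_one,
    dotProduct_comm x w, dotProduct_comm z y, smul_eq_mul, Fintype.card_fin]
  push_cast
  ring

lemma finrank_ker_trace_fin_three :
    Module.finrank F (LinearMap.ker (traceLinearMap (Fin 3) F F)) = 8 := by
  have hs : Function.Surjective (traceLinearMap (Fin 3) F F) := fun c =>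
    ⟨Matrix.single 0 0 c, by simp⟩
  have h := LinearMap.finrank_range_add_finrank_ker (traceLinearMap (Fin 3) F F)
  rw [LinearMap.range_eq_top.mpr hs, finrank_top, Module.finrank_self,
    Module.finrank_matrix, Fintype.card_fin, Module.finrank_self] at h
  omega

lemma stmt0_of_field (F : Type) [Field F] : Stmt0 F := by
  let φ := MmatLinear F ∘ₗ
    LinearMap.prodMap (LinearMap.ker (traceLinearMap (Fin 3) F F)).subtype LinearMap.id
  have hφ : Function.Injective φ :=
    MmatLinear_injective.comp
      (Function.Injective.prodMap (Submodule.injective_subtype _) Function.injective_id)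
  have hmem (M : Matrix Idx Idx F) : M ∈ LinearMap.range φ ↔ M ∈ LSet F := by
    constructor
    · rintro ⟨⟨⟨a, ha⟩, x, y⟩, rfl⟩
      exact ⟨a, x, y, ha, rfl⟩
    · rintro ⟨a, x, y, ha, rfl⟩
      exact ⟨⟨⟨a, ha⟩, x, y⟩, rfl⟩
  refine ⟨LinearMap.range φ, Set.ext hmem, fun A hA B hB => ?_, ?_⟩
  · obtain ⟨a, x, y, ha, rfl⟩ := (hmem A).mp hA
    obtain ⟨b, z, w, hb, rfl⟩ := (hmem B).mp hB
    exact (hmem _).mpr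
      ⟨_, _, _, trace_commutator_block a b x y z w, Mmat_commutator ha hb x y z w⟩
  · rw [LinearMap.finrank_range_of_inj hφ, Module.finrank_prod, Module.finrank_prod,
      finrank_ker_trace_fin_three, Module.finrank_fin_fun]

/-- For `F = ℝ` and `F = ℂ`, the set `L_F` is a 14-dimensional Lie subalgebra of `gl₇(F)`:
an `F`-linear subspace of the `7×7` matrices closed under the commutator bracket
`[A,B] = AB − BA`, of dimension `14` over `F`. -/
theorem stmt0 : Stmt0 ℝ ∧ Stmt0 ℂ :=
  ⟨stmt0_of_field ℝ, stmt0_of_field ℂ⟩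
end
end

section
/- Let N be the 7×7 block matrix [[−1, 0, 0], [0, 0, −2I₃], [0, −2I₃, 0]], which is the matrix of the bilinear form n. Then every matrix M = M(a,x,y) ∈ L_F satisfies Mᵀ N + N M = 0; equivalently, n(M X, Y) + n(X, M Y) = 0 for all X, Y ∈ F⁷, so L_F ⊆ so(F⁷, n). -/
open Matrix

noncomputable section

variable {F : Type} [Field F]

/-- The `7×7` block matrix `N = [[-1, 0, 0], [0, 0, -2I₃], [0, -2I₃, 0]]`
of the bilinear form `n`. -/
def Nmat (F : Type) [Field F] : Matrix Idx Idx F :=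
  Matrix.fromBlocks (-1) 0 0
    (Matrix.fromBlocks 0 ((-2 : F) • (1 : Matrix (Fin 3) (Fin 3) F))
      ((-2 : F) • (1 : Matrix (Fin 3) (Fin 3) F)) 0)

/-- Statement 2 for a given field `F`: every `M = M(a,x,y) ∈ L_F` satisfies
`Mᵀ N + N M = 0`; equivalently `n(MX, Y) + n(X, MY) = 0` for all `X, Y ∈ F⁷`
(where `n(X,Y) = Xᵀ N Y`), i.e. `L_F ⊆ so(F⁷, n)`. -/
def Stmt2 (F : Type) [Field F] : Prop :=
  ∀ (a : Matrix (Fin 3) (Fin 3) F) (x y : Fin 3 → F), Matrix.trace a = 0 →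
    (Mmat a x y)ᵀ * Nmat F + Nmat F * Mmat a x y = 0 ∧
    ∀ X Y : Idx → F,
      ((Mmat a x y).mulVec X) ⬝ᵥ ((Nmat F).mulVec Y)
        + X ⬝ᵥ ((Nmat F).mulVec ((Mmat a x y).mulVec Y)) = 0

theorem lmat_transpose (x : Fin 3 → F) : (lmat x)ᵀ = -lmat x := by
  ext i j
  fin_cases i <;> fin_cases j <;> simp [lmat]

theorem Mmat_transpose_mul_Nmat_add (a : Matrix (Fin 3) (Fin 3) F) (x y : Fin 3 → F) :
    (Mmat a x y)ᵀ * Nmat F + Nmat F * Mmat a x y = 0 := by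
  simp only [Mmat, Nmat, fromBlocks_transpose, fromBlocks_multiply, fromBlocks_add,
    lmat_transpose]
  ext (i | i | i) (j | j | j) <;>
    simp [Matrix.mul_apply, Matrix.one_apply, mul_comm]

theorem mulVec_dotProduct_add_eq_zero {n : Type*} [Fintype n] {M N : Matrix n n F}
    (h : Mᵀ * N + N * M = 0) (X Y : n → F) :
    M.mulVec X ⬝ᵥ N.mulVec Y + X ⬝ᵥ N.mulVec (M.mulVec Y) = 0 := by
  rw [← vecMul_transpose, ← dotProduct_mulVec, mulVec_mulVec, mulVec_mulVec, ← dotProduct_add,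
    ← add_mulVec, h, zero_mulVec, dotProduct_zero]

theorem stmt2_of_field (F : Type) [Field F] : Stmt2 F := fun a x y _ =>
  ⟨Mmat_transpose_mul_Nmat_add a x y,
    mulVec_dotProduct_add_eq_zero (Mmat_transpose_mul_Nmat_add a x y)⟩

/-- For `F = ℝ` and `F = ℂ`: every matrix `M = M(a,x,y) ∈ L_F` satisfies
`Mᵀ N + N M = 0`, equivalently `n(MX,Y) + n(X,MY) = 0` for all `X, Y ∈ F⁷`,
so `L_F ⊆ so(F⁷, n)`. -/
theorem stmt2 : Stmt2 ℝ ∧ Stmt2 ℂ :=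
  ⟨stmt2_of_field ℝ, stmt2_of_field ℂ⟩
end
end

section
/- For all X, Y ∈ F⁷ one has n(X × Y, X) = 0, n(X × Y, Y) = 0, and n(X × Y, X × Y) = n(X,X)·n(Y,Y) − n(X,Y)²; that is, the product × is a cross product on F⁷ relative to the norm n. -/
open Matrix

noncomputable section

/-- `F⁷`, identified with `F × F³ × F³`, elements written `(s, u, v)`. -/
abbrev V7 (F : Type) := F × (Fin 3 → F) × (Fin 3 → F)

variable {F : Type} [Field F]

/-- The quadratic form `n(s,u,v) = -s² - 4 uᵀv` on `F⁷`. -/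
def nq (X : V7 F) : F := -X.1 ^ 2 - 4 * (X.2.1 ⬝ᵥ X.2.2)

/-- The symmetric bilinear form associated to `n` by polarization. -/
def nb (X Y : V7 F) : F := (nq (X + Y) - nq X - nq Y) / 2

/-- The bilinear product `×` on `F⁷`:
`(s,u,v) × (t,x,y) = (2uᵀy - 2vᵀx, s·x - t·u - 2(v ×₃ y), -s·y + t·v + 2(u ×₃ x))`. -/
def cr (X Y : V7 F) : V7 F :=
  (2 * (X.2.1 ⬝ᵥ Y.2.2) - 2 * (X.2.2 ⬝ᵥ Y.2.1),
   X.1 • Y.2.1 - Y.1 • X.2.1 - (2 : F) • (crossProduct X.2.2 Y.2.2),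
   -(X.1 • Y.2.2) + Y.1 • X.2.2 + (2 : F) • (crossProduct X.2.1 Y.2.1))

/-- Statement 3, for a given field `F` (to be instantiated at `ℝ` and `ℂ`):
`×` is a cross product on `F⁷` relative to the norm `n`. -/
def Stmt3 (F : Type) [Field F] : Prop :=
  ∀ X Y : V7 F,
    nb (cr X Y) X = 0 ∧ nb (cr X Y) Y = 0 ∧
      nb (cr X Y) (cr X Y) = nb X X * nb Y Y - (nb X Y) ^ 2

theorem nb_eq (h2 : (2 : F) ≠ 0) (X Y : V7 F) :
    nb X Y = -X.1 * Y.1 - 2 * (X.2.1 ⬝ᵥ Y.2.2) - 2 * (X.2.2 ⬝ᵥ Y.2.1) := by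
  rw [nb, div_eq_iff h2]
  simp only [nq, Prod.fst_add, Prod.snd_add, add_dotProduct, dotProduct_add,
    dotProduct_comm X.2.2 Y.2.1]
  ring

theorem stmt3_of_two_ne_zero (h2 : (2 : F) ≠ 0) : Stmt3 F := by
  rintro ⟨s, u, v⟩ ⟨t, x, y⟩
  simp only [nb_eq h2, cr, cross_apply, dotProduct, Fin.sum_univ_three, Pi.add_apply,
    Pi.sub_apply, Pi.neg_apply, Pi.smul_apply, smul_eq_mul, Matrix.cons_val]
  refine ⟨?_, ?_, ?_⟩ <;> ring

/-- For `F = ℝ` and `F = ℂ`, the product `×` on `F⁷` is a cross product relative to `n`: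
`n(X × Y, X) = 0`, `n(X × Y, Y) = 0` and `n(X × Y, X × Y) = n(X,X)·n(Y,Y) − n(X,Y)²`. -/
theorem stmt3 : Stmt3 ℝ ∧ Stmt3 ℂ := by
  exact ⟨stmt3_of_two_ne_zero two_ne_zero, stmt3_of_two_ne_zero two_ne_zero⟩
end
end

section
/- A linear endomorphism f of F⁷ satisfies f(X × Y) = f(X) × Y + X × f(Y) for all X, Y ∈ F⁷ if and only if the matrix of f (in the standard basis) equals M(a,x,y) for some trace-zero 3×3 matrix a over F and some x, y ∈ F³; that is, L_F = Der(F⁷, ×). -/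
open Matrix

noncomputable section

variable {F : Type} [Field F]

/-- The action on `F⁷ = F × F³ × F³` of the `7×7` block matrix
`M(a,x,y) = [[0, -2yᵀ, -2xᵀ], [x, a, l_y], [y, l_x, -aᵀ]]` (in the standard basis):
`(s,u,v) ↦ (-2yᵀu - 2xᵀv, s·x + a·u + y ×₃ v, s·y + x ×₃ u - aᵀ·v)`. -/
def Mact (a : Matrix (Fin 3) (Fin 3) F) (x y : Fin 3 → F) (P : V7 F) : V7 F :=
  (-2 * (y ⬝ᵥ P.2.1) - 2 * (x ⬝ᵥ P.2.2),
   P.1 • x + a.mulVec P.2.1 + crossProduct y P.2.2,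
   P.1 • y + crossProduct x P.2.1 - aᵀ.mulVec P.2.2)

/-- Statement 4 for a given field `F`: a linear endomorphism `f` of `F⁷` is a derivation
of the cross product `×` iff its matrix in the standard basis is `M(a,x,y)` for some
trace-zero `a` and `x, y ∈ F³`; that is, `L_F = Der(F⁷, ×)`. -/
def Stmt4 (F : Type) [Field F] : Prop :=
  ∀ f : V7 F →ₗ[F] V7 F,
    (∀ X Y : V7 F, f (cr X Y) = cr (f X) Y + cr X (f Y)) ↔
    ∃ (a : Matrix (Fin 3) (Fin 3) F) (x y : Fin 3 → F),
      Matrix.trace a = 0 ∧ ∀ P : V7 F, f P = Mact a x y P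

/-- `M(a,x,y)` acts as a derivation of the cross product when `a` has trace zero. -/
theorem Mact_cr {a : Matrix (Fin 3) (Fin 3) F} (ha : a.trace = 0) (x y : Fin 3 → F) (X Y : V7 F) :
    Mact a x y (cr X Y) = cr (Mact a x y X) Y + cr X (Mact a x y Y) := by
  obtain ⟨s, u, v⟩ := X
  obtain ⟨t, w, z⟩ := Y
  have h : a 2 2 = -a 0 0 - a 1 1 := by
    rw [Matrix.trace_fin_three] at ha
    linear_combination ha
  refine Prod.ext ?_ (Prod.ext (funext fun i => ?_) (funext fun i => ?_))
  · simp [Mact, cr, cross_apply, dotProduct, mulVec, Fin.sum_univ_three, vecHead, vecTail, h]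
    ring
  all_goals
    fin_cases i <;>
    · simp [Mact, cr, cross_apply, dotProduct, mulVec, Fin.sum_univ_three, vecHead, vecTail, h]
      ring

section Derivation

variable {f : V7 F →ₗ[F] V7 F} (hf : ∀ X Y : V7 F, f (cr X Y) = cr (f X) Y + cr X (f Y))
include hf

theorem derivation_apply_left (h2 : (2 : F) ≠ 0) (u : Fin 3 → F) :
    (f (0, u, 0)).1 = -2 * ((f (1, 0, 0)).2.2 ⬝ᵥ u) ∧
      (f (0, u, 0)).2.2 = crossProduct (f (1, 0, 0)).2.1 u := by
  have h := hf (1, 0, 0) (0, u, 0)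
  rw [show cr ((1, 0, 0) : V7 F) (0, u, 0) = (0, u, 0) by simp [cr]] at h
  refine ⟨by simpa [cr] using congrArg (fun P => P.1) h, ?_⟩
  have h' : (f (0, u, 0)).2.2 =
      (2 : F) • crossProduct (f (1, 0, 0)).2.1 u - (f (0, u, 0)).2.2 := by
    simpa [cr, sub_eq_add_neg] using congrArg (fun P => P.2.2) h
  apply smul_right_injective _ h2
  simp only
  rw [two_smul F (f (0, u, 0)).2.2]
  exact eq_sub_iff_add_eq.1 h'

theorem derivation_apply_right (h2 : (2 : F) ≠ 0) (v : Fin 3 → F) :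
    (f (0, 0, v)).1 = -2 * ((f (1, 0, 0)).2.1 ⬝ᵥ v) ∧
      (f (0, 0, v)).2.1 = crossProduct (f (1, 0, 0)).2.2 v := by
  have h := hf (1, 0, 0) (0, 0, v)
  rw [show cr ((1, 0, 0) : V7 F) (0, 0, v) = -(0, 0, v) by simp [cr], map_neg] at h
  constructor
  · have h' : -(f (0, 0, v)).1 = 2 * ((f (1, 0, 0)).2.1 ⬝ᵥ v) := by
      simpa [cr] using congrArg (fun P => P.1) h
    linear_combination -h'
  have h' : -(f (0, 0, v)).2.1 =
      -((2 : F) • crossProduct (f (1, 0, 0)).2.2 v) + (f (0, 0, v)).2.1 := by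
    simpa [cr] using congrArg (fun P => P.2.1) h
  apply smul_right_injective _ h2
  simp only
  rw [two_smul F (f (0, 0, v)).2.1]
  linear_combination -h'

theorem derivation_apply_one_fst : (f (1, 0, 0)).1 = 0 := by
  have h := hf (1, 0, 0) (0, Pi.single 0 1, 0)
  rw [show cr ((1, 0, 0) : V7 F) (0, Pi.single 0 1, 0) = (0, Pi.single 0 1, 0) by simp [cr]] at h
  simpa [cr] using congrFun (congrArg (fun P => P.2.1) h) 0

theorem derivation_dotProduct (h2 : (2 : F) ≠ 0) (u v : Fin 3 → F) :
    (f (0, u, 0)).2.1 ⬝ᵥ v + u ⬝ᵥ (f (0, 0, v)).2.2 = 0 := by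
  have h := hf (0, u, 0) (0, 0, v)
  rw [show cr ((0, u, 0) : V7 F) (0, 0, v) = (2 * (u ⬝ᵥ v)) • (1, 0, 0) by simp [cr],
    map_smul] at h
  have h' := congrArg (fun P => P.1) h
  simp [cr, derivation_apply_one_fst hf] at h'
  apply mul_left_cancel₀ h2
  linear_combination -h'

theorem derivation_cross (h2 : (2 : F) ≠ 0) (u w : Fin 3 → F) :
    (f (0, 0, crossProduct u w)).2.2 =
      crossProduct (f (0, u, 0)).2.1 w + crossProduct u (f (0, w, 0)).2.1 := by
  have h := hf (0, u, 0) (0, w, 0)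
  rw [show cr ((0, u, 0) : V7 F) (0, w, 0) = (2 : F) • (0, 0, crossProduct u w) by simp [cr],
    map_smul] at h
  apply smul_right_injective _ h2
  simpa [cr] using congrArg (fun P => P.2.2) h

theorem exists_eq_Mact_of_derivation (h2 : (2 : F) ≠ 0) :
    ∃ (a : Matrix (Fin 3) (Fin 3) F) (x y : Fin 3 → F),
      Matrix.trace a = 0 ∧ ∀ P : V7 F, f P = Mact a x y P := by
  let A : (Fin 3 → F) →ₗ[F] (Fin 3 → F) :=
    LinearMap.fst F _ _ ∘ₗ LinearMap.snd F _ _ ∘ₗ f ∘ₗ LinearMap.inr F _ _ ∘ₗ LinearMap.inl F _ _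
  let a := LinearMap.toMatrix' A
  have hA (u : Fin 3 → F) : (f (0, u, 0)).2.1 = a *ᵥ u := (LinearMap.toMatrix'_mulVec A u).symm
  have hD (v : Fin 3 → F) : (f (0, 0, v)).2.2 = -(aᵀ *ᵥ v) := by
    rw [← dotProduct_eq_iff]
    intro u
    have h := derivation_dotProduct hf h2 u v
    rw [hA] at h
    rw [neg_dotProduct, mulVec_transpose, ← dotProduct_mulVec, dotProduct_comm v,
      dotProduct_comm _ u]
    linear_combination h
  refine ⟨a, (f (1, 0, 0)).2.1, (f (1, 0, 0)).2.2, ?_, ?_⟩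
  · have h := congrFun (derivation_cross hf h2 ![1, 0, 0] ![0, 1, 0]) 2
    rw [hA, hA, hD] at h
    simp [cross_apply, mulVec, dotProduct, Fin.sum_univ_three] at h
    rw [Matrix.trace_fin_three]
    linear_combination -h
  · rintro ⟨s, u, v⟩
    have hP : ((s, u, v) : V7 F) = s • (1, 0, 0) + (0, u, 0) + (0, 0, v) := by simp
    obtain ⟨hu₁, hu₂⟩ := derivation_apply_left hf h2 u
    obtain ⟨hv₁, hv₂⟩ := derivation_apply_right hf h2 v
    rw [hP, map_add, map_add, map_smul, ← hP]
    refine Prod.ext ?_ (Prod.ext ?_ ?_)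
    · simp [Mact, hu₁, hv₁, derivation_apply_one_fst hf, sub_eq_add_neg]
    · simp [Mact, hA, hv₂]
    · simp [Mact, hu₂, hD, sub_eq_add_neg]

end Derivation

theorem stmt4_of_two_ne_zero (h2 : (2 : F) ≠ 0) : Stmt4 F := by
  refine fun f => ⟨fun hf => exists_eq_Mact_of_derivation hf h2, ?_⟩
  rintro ⟨a, x, y, ha, h⟩ X Y
  simp only [h, Mact_cr ha]

/-- For `F = ℝ` and `F = ℂ`: a linear endomorphism `f` of `F⁷` satisfies
`f(X × Y) = f(X) × Y + X × f(Y)` for all `X, Y` iff the matrix of `f` in the standard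
basis equals `M(a,x,y)` for some trace-zero `3×3` matrix `a` and some `x, y ∈ F³`;
that is, `L_F = Der(F⁷, ×)`. -/
theorem stmt4 : Stmt4 ℝ ∧ Stmt4 ℂ :=
  ⟨stmt4_of_two_ne_zero two_ne_zero, stmt4_of_two_ne_zero two_ne_zero⟩
end
end

section
/- A linear endomorphism f of F⁷ satisfies Ω₀(f X, Y, Z) + Ω₀(X, f Y, Z) + Ω₀(X, Y, f Z) = 0 for all X, Y, Z ∈ F⁷ if and only if the matrix of f belongs to L_F; that is, L_F coincides with the Lie algebra of linear maps annihilating the 3-form Ω₀. -/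
open Matrix

noncomputable section

variable {F : Type} [Field F]

/-- The alternating 3-form `Ω₀(X,Y,Z) = n(X × Y, Z)` on `F⁷`. -/
def Omega0 (X Y Z : V7 F) : F := nb (cr X Y) Z

/-- Statement 7 for a given field `F`: a linear endomorphism `f` of `F⁷` annihilates
the 3-form `Ω₀` iff its matrix (in the standard basis) belongs to `L_F`. -/
def Stmt7 (F : Type) [Field F] : Prop :=
  ∀ f : V7 F →ₗ[F] V7 F,
    (∀ X Y Z : V7 F,
        Omega0 (f X) Y Z + Omega0 X (f Y) Z + Omega0 X Y (f Z) = 0) ↔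
    ∃ (a : Matrix (Fin 3) (Fin 3) F) (x y : Fin 3 → F),
      Matrix.trace a = 0 ∧ ∀ P : V7 F, f P = Mact a x y P

theorem Omega0_eq [NeZero (2 : F)] (X Y Z : V7 F) :
    Omega0 X Y Z = -(cr X Y).1 * Z.1
      - 2 * ((cr X Y).2.1 ⬝ᵥ Z.2.2 + (cr X Y).2.2 ⬝ᵥ Z.2.1) := by
  have h2 : (2 : F) ≠ 0 := NeZero.ne 2
  simp only [Omega0, nb, nq, Prod.fst_add, Prod.snd_add, add_dotProduct, dotProduct_add]
  rw [dotProduct_comm (cr X Y).2.2]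
  field_simp
  ring

theorem crossProduct_coord (u v : Fin 3 → F) :
    crossProduct u v 0 = u 1 * v 2 - u 2 * v 1 ∧
    crossProduct u v 1 = u 2 * v 0 - u 0 * v 2 ∧
    crossProduct u v 2 = u 0 * v 1 - u 1 * v 0 := by
  simp [cross_apply]

theorem Omega0_coord [NeZero (2 : F)] (X Y Z : V7 F) :
    Omega0 X Y Z =
      2 * (-Z.1 * (X.2.1 0 * Y.2.2 0 + X.2.1 1 * Y.2.2 1 + X.2.1 2 * Y.2.2 2
          - X.2.2 0 * Y.2.1 0 - X.2.2 1 * Y.2.1 1 - X.2.2 2 * Y.2.1 2)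
        - X.1 * (Y.2.1 0 * Z.2.2 0 + Y.2.1 1 * Z.2.2 1 + Y.2.1 2 * Z.2.2 2
          - Y.2.2 0 * Z.2.1 0 - Y.2.2 1 * Z.2.1 1 - Y.2.2 2 * Z.2.1 2)
        + Y.1 * (X.2.1 0 * Z.2.2 0 + X.2.1 1 * Z.2.2 1 + X.2.1 2 * Z.2.2 2
          - X.2.2 0 * Z.2.1 0 - X.2.2 1 * Z.2.1 1 - X.2.2 2 * Z.2.1 2)
        + 2 * ((X.2.2 1 * Y.2.2 2 - X.2.2 2 * Y.2.2 1) * Z.2.2 0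
          + (X.2.2 2 * Y.2.2 0 - X.2.2 0 * Y.2.2 2) * Z.2.2 1
          + (X.2.2 0 * Y.2.2 1 - X.2.2 1 * Y.2.2 0) * Z.2.2 2)
        - 2 * ((X.2.1 1 * Y.2.1 2 - X.2.1 2 * Y.2.1 1) * Z.2.1 0
          + (X.2.1 2 * Y.2.1 0 - X.2.1 0 * Y.2.1 2) * Z.2.1 1
          + (X.2.1 0 * Y.2.1 1 - X.2.1 1 * Y.2.1 0) * Z.2.1 2)) := by
  rw [Omega0_eq]
  simp only [cr, crossProduct_coord, dotProduct, Fin.sum_univ_three, Pi.add_apply, Pi.sub_apply,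
    Pi.neg_apply, Pi.smul_apply, smul_eq_mul]
  ring

theorem Omega0_Mact [NeZero (2 : F)] {a : Matrix (Fin 3) (Fin 3) F} (ha : a.trace = 0)
    (x y : Fin 3 → F) (X Y Z : V7 F) :
    Omega0 (Mact a x y X) Y Z + Omega0 X (Mact a x y Y) Z + Omega0 X Y (Mact a x y Z) = 0 := by
  have ha' : a 2 2 = -a 0 0 - a 1 1 := by
    rw [Matrix.trace_fin_three] at ha
    linear_combination ha
  simp only [Mact, Omega0_coord, crossProduct_coord, dotProduct, Matrix.mulVec,
    Matrix.transpose_apply, Fin.sum_univ_three, Pi.add_apply, Pi.sub_apply, Pi.smul_apply,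
    smul_eq_mul, ha']
  ring

theorem map_eq_sum_basis (f : V7 F →ₗ[F] V7 F) (P : V7 F) :
    f P = P.1 • f (1, 0, 0) + ∑ i, P.2.1 i • f (0, Pi.single i 1, 0)
      + ∑ i, P.2.2 i • f (0, 0, Pi.single i 1) := by
  simp only [← map_smul, ← map_sum, ← map_add]
  congr 1
  obtain ⟨s, u, v⟩ := P
  ext i
  · simp [Prod.fst_sum]
  · fin_cases i <;> simp [Fin.sum_univ_three]
  · fin_cases i <;> simp [Fin.sum_univ_three]

theorem exists_eq_Mact [CharZero F] (f : V7 F →ₗ[F] V7 F)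
    (h : ∀ X Y Z : V7 F,
      Omega0 (f X) Y Z + Omega0 X (f Y) Z + Omega0 X Y (f Z) = 0) :
    ∃ (a : Matrix (Fin 3) (Fin 3) F) (x y : Fin 3 → F),
      Matrix.trace a = 0 ∧ ∀ P : V7 F, f P = Mact a x y P := by
  let e : V7 F := (1, 0, 0)
  let p (i : Fin 3) : V7 F := (0, Pi.single i 1, 0)
  let q (i : Fin 3) : V7 F := (0, 0, Pi.single i 1)
  have epq (i j : Fin 3) := h e (p i) (q j)
  have epp (i j : Fin 3) := h e (p i) (p j)
  have eqq (i j : Fin 3) := h e (q i) (q j)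
  have ppq (i : Fin 3) := And.intro (h (p 0) (p 1) (q i))
    (And.intro (h (p 1) (p 2) (q i)) (h (p 2) (p 0) (q i)))
  have pqq (i : Fin 3) := And.intro (h (p i) (q 0) (q 1))
    (And.intro (h (p i) (q 1) (q 2)) (h (p i) (q 2) (q 0)))
  have ppp := h (p 0) (p 1) (p 2)
  have qqq := h (q 0) (q 1) (q 2)
  simp only [Fin.forall_fin_succ, Fin.forall_fin_zero] at epq epp eqq ppq pqq
  simp [Omega0_coord, e, p, q] at epq epp eqq ppq pqq ppp qqq
  refine ⟨Matrix.of fun i j => (f (p j)).2.1 i, (f e).2.1, (f e).2.2, ?_, fun P => ?_⟩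
  · simp [Matrix.trace_fin_three, p]
    grind
  rw [map_eq_sum_basis]
  simp only [Mact, Fin.sum_univ_three]
  ext i
  · simp [e, dotProduct, Fin.sum_univ_three]
    grind
  all_goals
    revert i
    simp [e, p, Fin.forall_fin_succ, Matrix.mulVec, crossProduct_coord, dotProduct,
      Fin.sum_univ_three]
    grind

/-- For `F = ℝ` and `F = ℂ`: a linear endomorphism `f` of `F⁷` satisfies
`Ω₀(fX,Y,Z) + Ω₀(X,fY,Z) + Ω₀(X,Y,fZ) = 0` for all `X, Y, Z` iff the matrix of `f`
belongs to `L_F`; that is, `L_F` is the Lie algebra of linear maps annihilating `Ω₀`. -/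
theorem stmt7 : Stmt7 ℝ ∧ Stmt7 ℂ := by
  exact ⟨fun f => ⟨exists_eq_Mact f, fun ⟨_, x, y, ha, hf⟩ X Y Z => by
    simpa only [hf] using Omega0_Mact ha x y X Y Z⟩, fun f => ⟨exists_eq_Mact f,
      fun ⟨_, x, y, ha, hf⟩ X Y Z => by simpa only [hf] using Omega0_Mact ha x y X Y Z⟩⟩
end
end

section
/- The group G_{Ω₁} = {g invertible linear endomorphism of ℝ⁷ : Ω₁(gX,gY,gZ) = Ω₁(X,Y,Z) for all X,Y,Z} acts transitively on the unit sphere S⁶: for any X, X' ∈ ℝ⁷ with ⟨X,X⟩ = ⟨X',X'⟩ = 1 (standard Euclidean inner product) there exists g ∈ G_{Ω₁} with g X = X'. -/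
open Matrix

noncomputable section

/-- The elementary alternating 3-form `eⁱ ∧ eʲ ∧ eᵏ` on `ℝ⁷`. -/
def eee (i j k : Fin 7) (X Y Z : Fin 7 → ℝ) : ℝ :=
  Matrix.det !![X i, X j, X k; Y i, Y j, Y k; Z i, Z j, Z k]

/-- The 3-form `Ω₁ = e¹⁴⁷ + e²⁵⁷ + e³⁶⁷ + e¹²³ − e¹⁵⁶ + e²⁴⁶ − e³⁴⁵` (1-based indices). -/
def Omega1 (X Y Z : Fin 7 → ℝ) : ℝ :=
  eee 0 3 6 X Y Z + eee 1 4 6 X Y Z + eee 2 5 6 X Y Z + eee 0 1 2 X Y Z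
    - eee 0 4 5 X Y Z + eee 1 3 5 X Y Z - eee 2 3 4 X Y Z

lemma eee_apply (i j k : Fin 7) (X Y Z : Fin 7 → ℝ) :
    eee i j k X Y Z = X i * Y j * Z k - X i * Y k * Z j - X j * Y i * Z k + X j * Y k * Z i
      + X k * Y i * Z j - X k * Y j * Z i := by
  simp [eee, Matrix.det_fin_three]

/-- The map of `ℝ⁷` rotating the coordinate planes `(i, j)` and `(k, l)` simultaneously, with
cosine `c` and sine `s`. -/
def doubleRotation (i j k l : Fin 7) (c s : ℝ) : (Fin 7 → ℝ) →ₗ[ℝ] (Fin 7 → ℝ) where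
  toFun X n :=
    if n = i then c * X i - s * X j
    else if n = j then s * X i + c * X j
    else if n = k then c * X k - s * X l
    else if n = l then s * X k + c * X l
    else X n
  map_add' X Y := by
    ext n
    simp only [Pi.add_apply]
    split_ifs <;> ring
  map_smul' a X := by
    ext n
    simp only [Pi.smul_apply, smul_eq_mul, RingHom.id_apply]
    split_ifs <;> ring

lemma doubleRotation_apply (i j k l : Fin 7) (c s : ℝ) (X : Fin 7 → ℝ) (n : Fin 7) :
    doubleRotation i j k l c s X n =
      if n = i then c * X i - s * X j
      else if n = j then s * X i + c * X j
      else if n = k then c * X k - s * X l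
      else if n = l then s * X k + c * X l
      else X n := rfl

lemma doubleRotation_neg_apply {i j k l : Fin 7} (hd : [i, j, k, l].Nodup) {c s : ℝ}
    (h : c ^ 2 + s ^ 2 = 1) (X : Fin 7 → ℝ) :
    doubleRotation i j k l c (-s) (doubleRotation i j k l c s X) = X := by
  simp only [List.nodup_cons, List.mem_cons, List.not_mem_nil, or_false, not_or] at hd
  obtain ⟨⟨hij, hik, hil⟩, ⟨hjk, hjl⟩, hkl, -⟩ := hd
  ext n
  simp only [doubleRotation_apply, Ne.symm hij, Ne.symm hik, Ne.symm hil,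
    Ne.symm hjk, Ne.symm hjl, Ne.symm hkl,
    if_true, if_false]
  split_ifs with h1 h2 h3 h4
  · subst h1; linear_combination X n * h
  · subst h2; linear_combination X n * h
  · subst h3; linear_combination X n * h
  · subst h4; linear_combination X n * h
  · rfl

/-- A double rotation as a linear automorphism. -/
def doubleRotationEquiv {i j k l : Fin 7} (hd : [i, j, k, l].Nodup) {c s : ℝ}
    (h : c ^ 2 + s ^ 2 = 1) : (Fin 7 → ℝ) ≃ₗ[ℝ] (Fin 7 → ℝ) :=
  { doubleRotation i j k l c s with
    invFun := doubleRotation i j k l c (-s)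
    left_inv := doubleRotation_neg_apply hd h
    right_inv := fun X => by
      simpa using doubleRotation_neg_apply hd (s := -s) (by simpa using h) X }

lemma doubleRotation_dotProduct_self {i j k l : Fin 7} (hd : [i, j, k, l].Nodup) {c s : ℝ}
    (h : c ^ 2 + s ^ 2 = 1) (X : Fin 7 → ℝ) :
    doubleRotation i j k l c s X ⬝ᵥ doubleRotation i j k l c s X = X ⬝ᵥ X := by
  simp only [List.nodup_cons, List.mem_cons, List.not_mem_nil, or_false, not_or] at hd
  obtain ⟨⟨hij, hik, hil⟩, ⟨hjk, hjl⟩, hkl, -⟩ := hd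
  rw [← sub_eq_zero, dotProduct, dotProduct, ← Finset.sum_sub_distrib,
    ← Finset.sum_subset (Finset.subset_univ ({i, j, k, l} : Finset (Fin 7)))]
  · rw [Finset.sum_insert (by simp [hij, hik, hil]), Finset.sum_insert (by simp [hjk, hjl]),
      Finset.sum_insert (by simp [hkl]), Finset.sum_singleton]
    simp only [doubleRotation_apply, Ne.symm hij, Ne.symm hik, Ne.symm hil,
    Ne.symm hjk, Ne.symm hjl, Ne.symm hkl,
      if_true, if_false]
    linear_combination (X i ^ 2 + X j ^ 2 + X k ^ 2 + X l ^ 2) * h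
  · intro n _ hn
    simp only [Finset.mem_insert, Finset.mem_singleton, not_or] at hn
    simp [doubleRotation_apply, hn]

/-- Some rotation of the plane takes `(a, b)` to the nonnegative second axis. -/
lemma exists_rotation_eq_zero (a b : ℝ) :
    ∃ c s : ℝ, c ^ 2 + s ^ 2 = 1 ∧ c * a - s * b = 0 ∧ 0 ≤ s * a + c * b := by
  rcases eq_or_ne (a ^ 2 + b ^ 2) 0 with h0 | h0
  · have ha : a = 0 := by nlinarith [sq_nonneg a, sq_nonneg b]
    have hb : b = 0 := by nlinarith [sq_nonneg a, sq_nonneg b]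
    exact ⟨1, 0, by simp, by simp [ha], by simp [hb]⟩
  · have hpos : 0 < a ^ 2 + b ^ 2 := lt_of_le_of_ne (by positivity) h0.symm
    have hr := Real.sqrt_pos.2 hpos
    have hsq := Real.sq_sqrt hpos.le
    set r := Real.sqrt (a ^ 2 + b ^ 2)
    refine ⟨b / r, a / r, ?_, by ring, ?_⟩
    · field_simp
      linarith
    · have : a / r * a + b / r * b = (a ^ 2 + b ^ 2) / r := by ring
      rw [this]
      positivity

/-- A self-map of `ℝ⁷` preserves `Ω₁`. -/
def PreservesOmega1 (g : (Fin 7 → ℝ) → (Fin 7 → ℝ)) : Prop :=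
  ∀ A B C : Fin 7 → ℝ, Omega1 (g A) (g B) (g C) = Omega1 A B C

/-- `X` and `Y` lie in the same orbit of the group `G_{Ω₁}`. -/
def SameOrbit (X Y : Fin 7 → ℝ) : Prop :=
  ∃ g : (Fin 7 → ℝ) ≃ₗ[ℝ] (Fin 7 → ℝ), PreservesOmega1 g ∧ g X = Y

lemma SameOrbit.symm {X Y : Fin 7 → ℝ} (h : SameOrbit X Y) : SameOrbit Y X := by
  obtain ⟨g, hg, rfl⟩ := h
  refine ⟨g.symm, fun A B C => ?_, g.symm_apply_apply X⟩
  simpa using (hg (g.symm A) (g.symm B) (g.symm C)).symm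

lemma SameOrbit.trans {X Y Z : Fin 7 → ℝ} (h : SameOrbit X Y) (h' : SameOrbit Y Z) :
    SameOrbit X Z := by
  obtain ⟨g, hg, rfl⟩ := h
  obtain ⟨g', hg', rfl⟩ := h'
  exact ⟨g.trans g', fun A B C => (hg' _ _ _).trans (hg A B C), rfl⟩

/-- If all double rotations in the planes `(i, 6)` and `(k, l)` preserve `Ω₁`, then they can be
used to clear the `i`-th coordinate of a vector without leaving its orbit. -/
lemma exists_sameOrbit_apply_eq_zero {i k l : Fin 7} (hd : [i, 6, k, l].Nodup)
    (hΩ : ∀ c s : ℝ, c ^ 2 + s ^ 2 = 1 → PreservesOmega1 (doubleRotation i 6 k l c s))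
    (X : Fin 7 → ℝ) :
    ∃ Y, SameOrbit X Y ∧ Y ⬝ᵥ Y = X ⬝ᵥ X ∧ Y i = 0 ∧ 0 ≤ Y 6 ∧
      (X k = 0 → X l = 0 → Y k = 0 ∧ Y l = 0) ∧
      ∀ n, n ∉ [i, 6, k, l] → Y n = X n := by
  obtain ⟨c, s, h, hi, h6⟩ := exists_rotation_eq_zero (X i) (X 6)
  refine ⟨doubleRotation i 6 k l c s X, ⟨doubleRotationEquiv hd h, hΩ c s h, rfl⟩,
    doubleRotation_dotProduct_self hd h X, ?_⟩
  simp only [List.nodup_cons, List.mem_cons, List.not_mem_nil, or_false, not_or] at hd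
  obtain ⟨⟨hij, hik, hil⟩, ⟨hjk, hjl⟩, hkl, -⟩ := hd
  simp only [doubleRotation_apply, Ne.symm hij, Ne.symm hik, Ne.symm hil,
    Ne.symm hjk, Ne.symm hjl, Ne.symm hkl,
    if_true, if_false]
  refine ⟨hi, h6, fun hk hl => by simp [hk, hl], fun n hn => ?_⟩
  simp only [List.mem_cons, List.not_mem_nil, or_false, not_or] at hn
  simp [hn]

lemma preservesOmega1_doubleRotation_0_6_2_4 {c s : ℝ} (h : c ^ 2 + s ^ 2 = 1) :
    PreservesOmega1 (doubleRotation 0 6 2 4 c s) := by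
  intro A B C
  simp [Omega1, eee_apply, doubleRotation_apply]
  linear_combination (norm := (simp only [Omega1, eee_apply]; ring))
    (Omega1 A B C - eee 1 3 5 A B C) * h

lemma preservesOmega1_doubleRotation_1_6_3_2 {c s : ℝ} (h : c ^ 2 + s ^ 2 = 1) :
    PreservesOmega1 (doubleRotation 1 6 3 2 c s) := by
  intro A B C
  simp [Omega1, eee_apply, doubleRotation_apply]
  linear_combination (norm := (simp only [Omega1, eee_apply]; ring))
    (Omega1 A B C + eee 0 4 5 A B C) * h

lemma preservesOmega1_doubleRotation_4_6_5_3 {c s : ℝ} (h : c ^ 2 + s ^ 2 = 1) :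
    PreservesOmega1 (doubleRotation 4 6 5 3 c s) := by
  intro A B C
  simp [Omega1, eee_apply, doubleRotation_apply]
  linear_combination (norm := (simp only [Omega1, eee_apply]; ring))
    (Omega1 A B C - eee 0 1 2 A B C) * h

lemma preservesOmega1_doubleRotation_5_6_1_0 {c s : ℝ} (h : c ^ 2 + s ^ 2 = 1) :
    PreservesOmega1 (doubleRotation 5 6 1 0 c s) := by
  intro A B C
  simp [Omega1, eee_apply, doubleRotation_apply]
  linear_combination (norm := (simp only [Omega1, eee_apply]; ring))
    (Omega1 A B C + eee 2 3 4 A B C) * h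

lemma preservesOmega1_doubleRotation_3_6_4_5 {c s : ℝ} (h : c ^ 2 + s ^ 2 = 1) :
    PreservesOmega1 (doubleRotation 3 6 4 5 c s) := by
  intro A B C
  simp [Omega1, eee_apply, doubleRotation_apply]
  linear_combination (norm := (simp only [Omega1, eee_apply]; ring))
    (Omega1 A B C - eee 0 1 2 A B C) * h

lemma preservesOmega1_doubleRotation_2_6_1_3 {c s : ℝ} (h : c ^ 2 + s ^ 2 = 1) :
    PreservesOmega1 (doubleRotation 2 6 1 3 c s) := by
  intro A B C
  simp [Omega1, eee_apply, doubleRotation_apply]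
  linear_combination (norm := (simp only [Omega1, eee_apply]; ring))
    (Omega1 A B C + eee 0 4 5 A B C) * h

lemma sameOrbit_single_of_dotProduct_self_eq_one {X : Fin 7 → ℝ} (hX : X ⬝ᵥ X = 1) :
    SameOrbit X (Pi.single 6 1) := by
  obtain ⟨X1, o1, d1, z1, p1, c1, f1⟩ := exists_sameOrbit_apply_eq_zero
    (i := 0) (k := 2) (l := 4) (by decide)
    (fun _ _ => preservesOmega1_doubleRotation_0_6_2_4) X
  obtain ⟨X2, o2, d2, z2, p2, c2, f2⟩ := exists_sameOrbit_apply_eq_zero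
    (i := 1) (k := 3) (l := 2) (by decide)
    (fun _ _ => preservesOmega1_doubleRotation_1_6_3_2) X1
  obtain ⟨X3, o3, d3, z3, p3, c3, f3⟩ := exists_sameOrbit_apply_eq_zero
    (i := 4) (k := 5) (l := 3) (by decide)
    (fun _ _ => preservesOmega1_doubleRotation_4_6_5_3) X2
  obtain ⟨X4, o4, d4, z4, p4, c4, f4⟩ := exists_sameOrbit_apply_eq_zero
    (i := 5) (k := 1) (l := 0) (by decide)
    (fun _ _ => preservesOmega1_doubleRotation_5_6_1_0) X3
  obtain ⟨X5, o5, d5, z5, p5, c5, f5⟩ := exists_sameOrbit_apply_eq_zero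
    (i := 3) (k := 4) (l := 5) (by decide)
    (fun _ _ => preservesOmega1_doubleRotation_3_6_4_5) X4
  obtain ⟨X6, o6, d6, z6, p6, c6, f6⟩ := exists_sameOrbit_apply_eq_zero
    (i := 2) (k := 1) (l := 3) (by decide)
    (fun _ _ => preservesOmega1_doubleRotation_2_6_1_3) X5
  have a0 : X2 0 = 0 := by rw [f2 0 (by decide), z1]
  have b0 : X3 0 = 0 := by rw [f3 0 (by decide), a0]
  have b1 : X3 1 = 0 := by rw [f3 1 (by decide), z2]
  obtain ⟨c1', c0⟩ := c4 b1 b0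
  have c4' : X4 4 = 0 := by rw [f4 4 (by decide), z3]
  have e0 : X5 0 = 0 := by rw [f5 0 (by decide), c0]
  have e1 : X5 1 = 0 := by rw [f5 1 (by decide), c1']
  obtain ⟨e4, e5⟩ := c5 c4' z4
  have g0 : X6 0 = 0 := by rw [f6 0 (by decide), e0]
  have g4 : X6 4 = 0 := by rw [f6 4 (by decide), e4]
  have g5 : X6 5 = 0 := by rw [f6 5 (by decide), e5]
  obtain ⟨g1, g3⟩ := c6 e1 z5
  have hn : X6 ⬝ᵥ X6 = 1 := by rw [d6, d5, d4, d3, d2, d1, hX]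
  have g6 : X6 6 = 1 := by
    simp only [dotProduct, Fin.sum_univ_seven, g0, g1, z6, g3, g4, g5] at hn
    nlinarith
  have hX6 : X6 = Pi.single 6 1 := by
    ext n
    fin_cases n <;> simp [g0, g1, z6, g3, g4, g5, g6]
  exact hX6 ▸ o1.trans (o2.trans (o3.trans (o4.trans (o5.trans o6))))

/-- the group `G_{Ω₁}` of invertible linear maps preserving `Ω₁` acts
transitively on the unit sphere `S⁶ ⊆ ℝ⁷` (for the standard Euclidean inner
product `⟨X,Y⟩ = X ⬝ᵥ Y`). -/
theorem stmt13 :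
    ∀ X X' : Fin 7 → ℝ, X ⬝ᵥ X = 1 → X' ⬝ᵥ X' = 1 →
      ∃ g : (Fin 7 → ℝ) ≃ₗ[ℝ] (Fin 7 → ℝ),
        (∀ A B C : Fin 7 → ℝ, Omega1 (g A) (g B) (g C) = Omega1 A B C) ∧
        g X = X' := by
  intro X X' hX hX'
  exact (sameOrbit_single_of_dotProduct_self_eq_one hX).trans
    (sameOrbit_single_of_dotProduct_self_eq_one hX').symm
end
end

section
/- Let f be an invertible linear endomorphism of W = F⁷ with f(X ∧ Y) = f(X) ∧ f(Y) for all X, Y ∈ W. Then f preserves the norm and the 3-form: n(fX, fY) = n(X,Y) and Ω(fX, fY, fZ) = Ω(X,Y,Z) for all X, Y, Z ∈ W; moreover the extension f̃ of f to C determined by f̃(1,0) = (1,0) and f̃(0,X) = (0, f X) is an algebra automorphism of C. Conversely, every algebra automorphism of C fixes (1,0), preserves the subspace {0} × W, and its restriction to W is an automorphism of (W, ∧); so f ↦ f̃ is a group isomorphism from Aut(W, ∧) onto Aut(C), and Aut(W, ∧) ⊆ O(W, n) ∩ G_Ω. -/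
open Matrix

noncomputable section

variable {F : Type} [Field F]

/-- The octonion product on `C = F × W` built from a bilinear form `n` and a cross
product `∧` (here `w`) on `W = F⁷`:
`(α,X)·(β,Y) = (αβ − n(X,Y), α·Y + β·X + X ∧ Y)`. -/
def omulW (n : (Fin 7 → F) → (Fin 7 → F) → F)
    (w : (Fin 7 → F) → (Fin 7 → F) → (Fin 7 → F))
    (P Q : F × (Fin 7 → F)) : F × (Fin 7 → F) :=
  (P.1 * Q.1 - n P.2 Q.2, P.1 • Q.2 + Q.1 • P.2 + w P.2 Q.2)

/-- Statement 19 for a given field `F`. -/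
def Stmt19 (F : Type) [Field F] : Prop :=
  ∀ (n : (Fin 7 → F) → (Fin 7 → F) → F)
    (w : (Fin 7 → F) → (Fin 7 → F) → (Fin 7 → F)),
    -- `n` is a nondegenerate symmetric bilinear form on `W = F⁷`
    (∀ X X' Y, n (X + X') Y = n X Y + n X' Y) →
    (∀ (c : F) X Y, n (c • X) Y = c * n X Y) →
    (∀ X Y Y', n X (Y + Y') = n X Y + n X Y') →
    (∀ (c : F) X Y, n X (c • Y) = c * n X Y) →
    (∀ X Y, n X Y = n Y X) →
    (∀ X, (∀ Y, n X Y = 0) → X = 0) →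
    -- `∧` is a bilinear product on `W`
    (∀ X X' Y, w (X + X') Y = w X Y + w X' Y) →
    (∀ (c : F) X Y, w (c • X) Y = c • w X Y) →
    (∀ X Y Y', w X (Y + Y') = w X Y + w X Y') →
    (∀ (c : F) X Y, w X (c • Y) = c • w X Y) →
    -- `∧` is a cross product relative to `n`: `X ∧ (X ∧ Y) = n(X,Y)X − n(X)Y`
    (∀ X Y, w X (w X Y) = n X Y • X - n X X • Y) →
    -- conclusions:
    -- (a) any invertible `f` with `f(X ∧ Y) = f(X) ∧ f(Y)` preserves `n` and the
    -- 3-form `Ω(X,Y,Z) = n(X ∧ Y, Z)`, and extends to an automorphism of `C`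
    ((∀ f : (Fin 7 → F) ≃ₗ[F] (Fin 7 → F),
        (∀ X Y, f (w X Y) = w (f X) (f Y)) →
        (∀ X Y, n (f X) (f Y) = n X Y) ∧
        (∀ X Y Z, n (w (f X) (f Y)) (f Z) = n (w X Y) Z) ∧
        (∀ P Q : F × (Fin 7 → F),
          omulW n w ((P.1, f P.2) : F × (Fin 7 → F)) ((Q.1, f Q.2) : F × (Fin 7 → F))
            = (((omulW n w P Q).1, f (omulW n w P Q).2) : F × (Fin 7 → F)))) ∧
    -- (b) conversely, every algebra automorphism `φ` of `C` fixes the unit,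
    -- preserves `{0} × W`, restricts to an automorphism of `(W, ∧)`, and is the
    -- extension of that restriction
     (∀ φ : (F × (Fin 7 → F)) ≃ₗ[F] (F × (Fin 7 → F)),
        (∀ P Q, φ (omulW n w P Q) = omulW n w (φ P) (φ Q)) →
        φ ((1, 0) : F × (Fin 7 → F)) = ((1, 0) : F × (Fin 7 → F)) ∧
        (∀ X : Fin 7 → F, (φ ((0, X) : F × (Fin 7 → F))).1 = 0) ∧
        (∀ X Y : Fin 7 → F,
          (φ ((0, w X Y) : F × (Fin 7 → F))).2
            = w (φ ((0, X) : F × (Fin 7 → F))).2 (φ ((0, Y) : F × (Fin 7 → F))).2) ∧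
        ∃ f : (Fin 7 → F) ≃ₗ[F] (Fin 7 → F),
          (∀ X Y, f (w X Y) = w (f X) (f Y)) ∧
          ∀ P : F × (Fin 7 → F), φ P = ((P.1, f P.2) : F × (Fin 7 → F))))

/-- A vector product satisfying the cross product identity is alternating. -/
theorem cross_self_eq_zero [CharZero F] {V : Type*} [AddCommGroup V] [Module F V]
    (n : V → V → F) (w : V → V → V)
    (n_add : ∀ X X' Y, n (X + X') Y = n X Y + n X' Y)
    (n_smul : ∀ (c : F) X Y, n (c • X) Y = c * n X Y)
    (n_symm : ∀ X Y, n X Y = n Y X)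
    (n_nondeg : ∀ X, (∀ Y, n X Y = 0) → X = 0)
    (add_w : ∀ X X' Y, w (X + X') Y = w X Y + w X' Y)
    (smul_w : ∀ (c : F) X Y, w (c • X) Y = c • w X Y)
    (w_add : ∀ X Y Y', w X (Y + Y') = w X Y + w X Y')
    (w_smul : ∀ (c : F) X Y, w X (c • Y) = c • w X Y)
    (w_w : ∀ X Y, w X (w X Y) = n X Y • X - n X X • Y) (X : V) : w X X = 0 := by
  have n_add' : ∀ X Y Y', n X (Y + Y') = n X Y + n X Y' := fun X Y Y' => by
    rw [n_symm, n_add, n_symm Y, n_symm Y']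
  have n_smul' : ∀ (c : F) X Y, n X (c • Y) = c * n X Y := fun c X Y => by
    rw [n_symm, n_smul, n_symm Y]
  have w_zero : ∀ X, w X 0 = 0 := fun X => by simpa using w_smul 0 X 0
  have w_w_self : ∀ X, w X (w X X) = 0 := fun X => by rw [w_w, sub_self]
  have anisotropic : ∀ X, n X X ≠ 0 → w X X = 0 := by
    intro X hX
    have h := w_w X (w X X)
    rw [w_w_self, w_zero] at h
    have hc : w X X = (n X (w X X) / n X X) • X := by
      rw [div_eq_inv_mul, mul_smul, sub_eq_zero.mp h.symm, inv_smul_smul₀ hX]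
    generalize n X (w X X) / n X X = c at hc
    have h2 := w_w_self X
    rw [hc, w_smul, hc, smul_smul] at h2
    rcases smul_eq_zero.mp h2 with h3 | h3
    · rw [hc, mul_self_eq_zero.mp h3, zero_smul]
    · rw [hc, h3, smul_zero]
  by_cases hX : n X X = 0
  swap
  · exact anisotropic X hX
  by_cases h0 : X = 0
  · rw [h0, w_zero]
  obtain ⟨Y, hY⟩ : ∃ Y, n X Y ≠ 0 := by
    by_contra! h
    exact h0 (n_nondeg X h)
  obtain ⟨Z, hXZ, hZ⟩ : ∃ Z, n X Z ≠ 0 ∧ n Z Z = 0 := by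
    refine ⟨Y + (-(n Y Y) / (2 * n X Y)) • X, ?_, ?_⟩
    · rwa [n_add', n_smul', hX, mul_zero, add_zero]
    · simp only [n_add, n_add', n_smul, n_smul', hX, n_symm Y X]
      field_simp
      ring
  have line : ∀ t : F, t ≠ 0 → w X X + t • (w X Z + w Z X) + (t * t) • w Z Z = 0 := by
    intro t ht
    have h := anisotropic (X + t • Z) (by
      simp only [n_add, n_add', n_smul, n_smul', hX, hZ, n_symm Z X]
      have : t * n X Z ≠ 0 := mul_ne_zero ht hXZ
      rw [zero_add, mul_zero, mul_zero, add_zero, ← two_mul]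
      exact mul_ne_zero two_ne_zero this)
    rw [← h]
    simp only [add_w, w_add, smul_w, w_smul]
    module
  have h1 := line 1 one_ne_zero
  have h2 := line (-1) (neg_ne_zero.mpr one_ne_zero)
  have h3 := line 2 two_ne_zero
  have h4 : (3 : F) • w X X = 0 := by
    linear_combination (norm := module) (3 : F) • h1 + (1 : F) • h2 - (1 : F) • h3
  exact (smul_eq_zero.mp h4).resolve_left three_ne_zero

/-- An automorphism of a cross product preserves the bilinear form. -/
theorem form_map_eq_of_map_cross [CharZero F] {V : Type*} [AddCommGroup V] [Module F V]
    (hV : 1 < Module.finrank F V) (n : V → V → F) (w : V → V → V)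
    (n_add : ∀ X X' Y, n (X + X') Y = n X Y + n X' Y)
    (n_symm : ∀ X Y, n X Y = n Y X)
    (w_w : ∀ X Y, w X (w X Y) = n X Y • X - n X X • Y)
    (f : V ≃ₗ[F] V) (hf : ∀ X Y, f (w X Y) = w (f X) (f Y)) (X Y : V) :
    n (f X) (f Y) = n X Y := by
  have n_add' : ∀ X Y Y', n X (Y + Y') = n X Y + n X Y' := fun X Y Y' => by
    rw [n_symm, n_add, n_symm Y, n_symm Y']
  have n_zero : n 0 0 = 0 := by simpa using n_add 0 0 0
  have diag : ∀ X, n (f X) (f X) = n X X := by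
    intro X
    by_cases hX : X = 0
    · simp [hX]
    obtain ⟨Y, hY⟩ := exists_linearIndependent_pair_of_one_lt_finrank hV hX
    have h := congrArg f (w_w X Y)
    rw [hf, hf, w_w, map_sub, map_smul, map_smul, ← map_smul, ← map_smul, ← map_smul,
      ← map_smul, ← map_sub, ← map_sub] at h
    have h' := f.injective h
    have key := LinearIndependent.pair_iff.mp hY
      (n (f X) (f Y) - n X Y) (n X X - n (f X) (f X)) (by
        linear_combination (norm := module) h')
    exact (sub_eq_zero.mp key.2).symm
  have h := diag (X + Y)
  simp only [map_add, n_add, n_add', diag, n_symm Y X, n_symm (f Y) (f X)] at h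
  have h2 : (2 : F) * n (f X) (f Y) = 2 * n X Y := by linear_combination h
  exact mul_left_cancel₀ two_ne_zero h2

theorem stmt19_of_charZero (F : Type) [Field F] [CharZero F] : Stmt19 F := by
  intro n w n_add n_smul n_add' n_smul' n_symm n_nondeg add_w smul_w w_add w_smul w_w
  have n_zero : ∀ X, n X 0 = 0 := fun X => by simpa using n_smul' 0 X 0
  have zero_n : ∀ X, n 0 X = 0 := fun X => by simpa using n_smul 0 0 X
  have w_zero : ∀ X, w X 0 = 0 := fun X => by simpa using w_smul 0 X 0
  have zero_w : ∀ X, w 0 X = 0 := fun X => by simpa using smul_w 0 0 X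
  have w_self := cross_self_eq_zero n w n_add n_smul n_symm n_nondeg add_w smul_w w_add
    w_smul w_w
  refine ⟨fun f hf => ?_, fun φ hφ => ?_⟩
  · have hn := form_map_eq_of_map_cross (by simp) n w n_add n_symm w_w f hf
    refine ⟨hn, fun X Y Z => by rw [← hf, hn], fun P Q => ?_⟩
    simp [omulW, hn, hf]
  · have one_mul' : ∀ P, omulW n w (1, 0) P = P := fun P => by
      simp [omulW, zero_n, zero_w]
    have mul_one' : ∀ P, omulW n w P (1, 0) = P := fun P => by
      simp [omulW, n_zero, w_zero]
    have map_one' : φ (1, 0) = (1, 0) := by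
      have h := hφ (1, 0) (φ.symm (1, 0))
      rwa [one_mul', φ.apply_symm_apply, mul_one', eq_comm] at h
    have map_scalar : ∀ a : F, φ (a, 0) = (a, 0) := fun a => by
      have h := φ.map_smul a (1, 0)
      rw [map_one'] at h
      simpa using h
    have map_fst : ∀ X, (φ (0, X)).1 = 0 := by
      intro X
      have h := hφ (0, X) (0, X)
      have hsq : omulW n w (0, X) (0, X) = (-n X X, 0) := by simp [omulW, w_self]
      rw [hsq, map_scalar] at h
      have h2 : (2 * (φ (0, X)).1) • (φ (0, X)).2 = 0 := by
        have h3 := congrArg Prod.snd h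
        simp only [omulW, w_self, add_zero, ← two_smul F, smul_smul] at h3
        exact h3.symm
      rcases smul_eq_zero.mp h2 with h3 | h3
      · exact (mul_eq_zero.mp h3).resolve_left two_ne_zero
      · have h4 : φ (0, X) = φ ((φ (0, X)).1, 0) := by
          rw [map_scalar]
          exact Prod.ext rfl h3
        exact (congrArg Prod.fst (φ.injective h4)).symm
    have map_snd : ∀ X, φ (0, X) = (0, (φ (0, X)).2) := fun X => Prod.ext (map_fst X) rfl
    have map_pair : ∀ P : F × (Fin 7 → F), φ P = (P.1, (φ (0, P.2)).2) := fun P => by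
      have hP : P = (P.1, 0) + (0, P.2) := by simp
      conv_lhs => rw [hP, map_add, map_scalar, map_snd]
      simp
    have map_cross : ∀ X Y, (φ (0, w X Y)).2 = w (φ (0, X)).2 (φ (0, Y)).2 := by
      intro X Y
      have h := congrArg Prod.snd (hφ (0, X) (0, Y))
      rw [map_pair] at h
      simpa [omulW, map_fst] using h
    let g : (Fin 7 → F) →ₗ[F] (Fin 7 → F) :=
      LinearMap.snd F F _ ∘ₗ φ.toLinearMap ∘ₗ LinearMap.inr F F _
    have g_apply : ∀ X, g X = (φ (0, X)).2 := fun X => rfl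
    have g_inj : Function.Injective g := fun X Y h => by
      have h' : φ (0, X) = φ (0, Y) := by rw [map_snd X, map_snd Y, ← g_apply, h, g_apply]
      exact congrArg Prod.snd (φ.injective h')
    exact ⟨map_one', map_fst, map_cross, LinearEquiv.ofInjectiveEndo g g_inj,
      map_cross, map_pair⟩

/-- For `F = ℝ` and `F = ℂ`, with `W = F⁷`, `n` a nondegenerate symmetric bilinear
form and `∧` a cross product relative to `n`: every invertible linear `f` preserving
`∧` preserves `n` and the 3-form `Ω(X,Y,Z) = n(X∧Y,Z)`, and its unital extension
`f̃` is an algebra automorphism of the octonion algebra `C = F × W`; conversely every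
algebra automorphism of `C` fixes `(1,0)`, preserves `{0} × W` and restricts to an
automorphism of `(W,∧)`, so `f ↦ f̃` is a group isomorphism `Aut(W,∧) ≅ Aut(C)`,
and `Aut(W,∧) ⊆ O(W,n) ∩ G_Ω`. -/
theorem stmt19 : Stmt19 ℝ ∧ Stmt19 ℂ := by
  exact ⟨stmt19_of_charZero ℝ, stmt19_of_charZero ℂ⟩
end
end
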